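/- arXiv:2412.05343 — 3 statements merged into one kernel-verified Lean document; each statement's English description precedes it below -/
import Mathlib

section
/- Let d ≥ 1, let p : ℝ^d → (0, ∞) be continuously differentiable, let g_1, …, g_n : ℝ^d → ℝ^d be continuously differentiable maps, and let w_1, …, w_n ≥ 0 with w_1 + … + w_n = 1. Assume p is π-equivariant for the finitely supported distribution π assigning weight w_i to g_i, i.e. log p(x) = Σ_{i=1}^n w_i log p(g_i(x)) for every x ∈ ℝ^d. Then the score s := ∇ log p satisfies s(x) = Σ_{i=1}^n w_i J_{g_i}(x)ᵀ s(g_i(x)) for every x ∈ ℝ^d, where J_{g_i}(x) denotes the Jacobian matrix of g_i at x. -/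
/-- Chain rule for the gradient: `∇ (f ∘ g) x = (Dg x)ᵀ ∇ f (g x)`. -/
theorem HasGradientAt.comp_hasFDerivAt {E F : Type*}
    [NormedAddCommGroup E] [InnerProductSpace ℝ E] [CompleteSpace E]
    [NormedAddCommGroup F] [InnerProductSpace ℝ F] [CompleteSpace F]
    {f : F → ℝ} {f' : F} {g : E → F} {g' : E →L[ℝ] F} {x : E}
    (hf : HasGradientAt f f' (g x)) (hg : HasFDerivAt g g' x) :
    HasGradientAt (fun y => f (g y)) (ContinuousLinearMap.adjoint g' f') x := by
  rw [hasGradientAt_iff_hasFDerivAt] at hf ⊢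
  refine (HasFDerivAt.comp x hf hg).congr_fderiv ?_
  ext v
  simp [ContinuousLinearMap.adjoint_inner_left]

/-- The gradient of a finite linear combination. -/
theorem HasGradientAt.fun_sum_const_mul {ι E : Type*} [Fintype ι]
    [NormedAddCommGroup E] [InnerProductSpace ℝ E] [CompleteSpace E]
    {f : ι → E → ℝ} {f' : ι → E} {x : E} (c : ι → ℝ)
    (hf : ∀ i, HasGradientAt (f i) (f' i) x) :
    HasGradientAt (fun y => ∑ i, c i * f i y) (∑ i, c i • f' i) x := by
  simp only [hasGradientAt_iff_hasFDerivAt] at hf ⊢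
  refine (HasFDerivAt.fun_sum (u := Finset.univ)
    fun i _ => (hf i).const_mul (c i)).congr_fderiv ?_
  ext v
  simp

/-- **Score identity for a π-equivariant prior (finitely supported π).**
If `p : ℝ^d → (0,∞)` is `C¹`, the maps `g i` are `C¹`, the weights `w i ≥ 0` sum to `1`, and
`log p x = ∑ i, w i * log p (g i x)` for all `x` (π-equivariance), then the score
`s = ∇ log p` satisfies `s x = ∑ i, w i • J_{g i}(x)ᵀ s (g i x)`. -/
theorem score_equivariance (d n : ℕ) (hd : 1 ≤ d)
    (p : EuclideanSpace ℝ (Fin d) → ℝ)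
    (hp : ContDiff ℝ 1 p) (hppos : ∀ y, 0 < p y)
    (g : Fin n → EuclideanSpace ℝ (Fin d) → EuclideanSpace ℝ (Fin d))
    (hg : ∀ i, ContDiff ℝ 1 (g i))
    (w : Fin n → ℝ) (hw : ∀ i, 0 ≤ w i) (hw1 : ∑ i, w i = 1)
    (hequiv : ∀ x, Real.log (p x) = ∑ i, w i * Real.log (p (g i x)))
    (x : EuclideanSpace ℝ (Fin d)) :
    gradient (fun y => Real.log (p y)) x =
      ∑ i, w i • ContinuousLinearMap.adjoint (fderiv ℝ (g i) x)
        (gradient (fun y => Real.log (p y)) (g i x)) := by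
  have hlog : Differentiable ℝ fun y => Real.log (p y) :=
    (hp.differentiable one_ne_zero).log fun y => (hppos y).ne'
  have hsum := HasGradientAt.fun_sum_const_mul w fun i =>
    (hlog (g i x)).hasGradientAt.comp_hasFDerivAt
      ((hg i).differentiable one_ne_zero x).hasFDerivAt
  simp only [← hequiv] at hsum
  exact hsum.gradient
end

section
/- Let d ≥ 1, let s, s̃ : ℝ^d → ℝ^d be measurable, and let (Θ, 𝒜, π) be a probability space with g : Θ × ℝ^d → ℝ^d jointly measurable, each g_θ continuously differentiable, and Jacobians J_{g_θ}(x) jointly measurable. Let K ⊂ ℝ^d be compact and assume: (i) there exists C_K < ∞ with ‖g_θ(x)‖ ≤ C_K for every x ∈ K and θ ∈ Θ; (ii) A := sup_{x ∈ ℝ^d} ∫_Θ ‖J_{g_θ}(x)‖ dπ(θ) < ∞; (iii) s satisfies the equivariance identity s(x) = ∫_Θ J_{g_θ}(x)ᵀ s(g_θ(x)) dπ(θ) for every x ∈ ℝ^d. Define s̃^π(x) = ∫_Θ J_{g_θ}(x)ᵀ s̃(g_θ(x)) dπ(θ) and L = closed ball B̄(0, C_K). Then sup_{x ∈ K} ‖s(x)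 − s̃^π(x)‖ ≤ A · sup_{y ∈ L} ‖s̃(y) − s(y)‖. -/
open MeasureTheory

/-- **Uniform score approximation (core of Proposition 4).**
Let `s` satisfy the π-equivariance score identity `s x = ∫ J_{g_θ}(x)ᵀ s (g_θ x) dπ(θ)`,
let `s̃^π x = ∫ J_{g_θ}(x)ᵀ s̃ (g_θ x) dπ(θ)` be the equivariant score associated with `s̃`,
and assume the transformations map the compact `K` into the closed ball `L = B̄(0, C_K)` and
`∫ ‖J_{g_θ}(x)‖ dπ ≤ A` for all `x`. Then for every upper bound `B` of `‖s̃ − s‖` on `L`,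
`sup_{x ∈ K} ‖s x − s̃^π x‖ ≤ A * B`. -/
theorem uniform_score_bound (d : ℕ) (hd : 1 ≤ d)
    (s stilde : EuclideanSpace ℝ (Fin d) → EuclideanSpace ℝ (Fin d))
    (hs : Measurable s) (hstilde : Measurable stilde)
    (Θ : Type*) [MeasurableSpace Θ] (π : Measure Θ) [IsProbabilityMeasure π]
    (g : Θ → EuclideanSpace ℝ (Fin d) → EuclideanSpace ℝ (Fin d))
    (hgm : Measurable fun q : Θ × EuclideanSpace ℝ (Fin d) => g q.1 q.2)
    (hgC : ∀ θ, ContDiff ℝ 1 (g θ))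
    (hJm : StronglyMeasurable fun q : Θ × EuclideanSpace ℝ (Fin d) =>
      fderiv ℝ (g q.1) q.2)
    (K : Set (EuclideanSpace ℝ (Fin d))) (hK : IsCompact K)
    (CK : ℝ) (hCK : ∀ x ∈ K, ∀ θ, ‖g θ x‖ ≤ CK)
    (A : ℝ)
    (hJint : ∀ x, Integrable (fun θ => ‖fderiv ℝ (g θ) x‖) π)
    (hA : ∀ x, ∫ θ, ‖fderiv ℝ (g θ) x‖ ∂π ≤ A)
    (hsint : ∀ x, Integrable (fun θ =>
      ContinuousLinearMap.adjoint (fderiv ℝ (g θ) x) (s (g θ x))) π)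
    (hstint : ∀ x, Integrable (fun θ =>
      ContinuousLinearMap.adjoint (fderiv ℝ (g θ) x) (stilde (g θ x))) π)
    (hequiv : ∀ x, s x =
      ∫ θ, ContinuousLinearMap.adjoint (fderiv ℝ (g θ) x) (s (g θ x)) ∂π)
    (B : ℝ)
    (hB : ∀ y ∈ Metric.closedBall (0 : EuclideanSpace ℝ (Fin d)) CK,
      ‖stilde y - s y‖ ≤ B) :
    ∀ x ∈ K,
      ‖s x - ∫ θ, ContinuousLinearMap.adjoint (fderiv ℝ (g θ) x)
          (stilde (g θ x)) ∂π‖ ≤ A * B := by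
  intro x hx
  obtain ⟨θ₀⟩ : Nonempty Θ := nonempty_of_isProbabilityMeasure π
  have hmem : ∀ θ, g θ x ∈ Metric.closedBall (0 : EuclideanSpace ℝ (Fin d)) CK := fun θ =>
    mem_closedBall_zero_iff.mpr (hCK x hx θ)
  have hB0 : 0 ≤ B := (norm_nonneg _).trans (hB _ (hmem θ₀))
  have hpoint : ∀ θ, ‖ContinuousLinearMap.adjoint (fderiv ℝ (g θ) x) (s (g θ x)) -
      ContinuousLinearMap.adjoint (fderiv ℝ (g θ) x) (stilde (g θ x))‖ ≤
      ‖fderiv ℝ (g θ) x‖ * B := by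
    intro θ
    rw [← map_sub, ← LinearIsometryEquiv.norm_map ContinuousLinearMap.adjoint (fderiv ℝ (g θ) x)]
    refine ContinuousLinearMap.le_opNorm_of_le _ ?_
    rw [norm_sub_rev]
    exact hB _ (hmem θ)
  rw [hequiv x, ← integral_sub (hsint x) (hstint x)]
  calc _ ≤ ∫ θ, ‖fderiv ℝ (g θ) x‖ * B ∂π :=
        norm_integral_le_of_norm_le ((hJint x).mul_const B) (Filter.Eventually.of_forall hpoint)
    _ = (∫ θ, ‖fderiv ℝ (g θ) x‖ ∂π) * B := integral_mul_const _ _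
    _ ≤ A * B := mul_le_mul_of_nonneg_right (hA x) hB0
end

section
/- Let d ≥ 1 and let p : ℝ^d → (0, ∞) be a continuously differentiable probability density with sup_x p(x) + sup_x ‖∇p(x)‖ < ∞. For σ > 0 let p_σ be its Gaussian smoothing and s_σ^π(x) = ∫_Θ J_{g_θ}(x)ᵀ (∇ log p_σ)(g_θ(x)) dπ(θ) the equivariant smoothed score for a family of transformations (Θ, 𝒜, π, g) with g jointly measurable, each g_θ continuously differentiable, and Jacobians jointly measurable. Assume: (i) for every compact K ⊂ ℝ^d there exists C_K < ∞ with ‖g_θ(x)‖ ≤ C_K for all x ∈ K and θ ∈ Θ; (ii) sup_{x ∈ ℝ^d} ∫_Θ ‖J_{g_θ}(x)‖ dπ(θ) < ∞; (iii) the score s = ∇ log p satisfies the π-equivariance identity s(x) = ∫_Θ J_{g_θ}(x)ᵀ s(g_θ(x)) dπ(θ) for every x ∈ ℝ^d. Then for every compact K ⊂ ℝ^d, sup_{x ∈ K} ‖s(x) − s_σ^π(x)‖ → 0 as σ → 0. -/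
open MeasureTheory

section GaussianSmoothing

variable {V F : Type*} [NormedAddCommGroup V] [InnerProductSpace ℝ V]
  [NormedAddCommGroup F] [NormedSpace ℝ F]

/-- The density of the standard Gaussian on a finite-dimensional inner product space. -/
noncomputable def stdGaussianDensity (u : V) : ℝ :=
  (2 * Real.pi) ^ (-(Module.finrank ℝ V : ℝ) / 2) * Real.exp (-(1 / 2) * ‖u‖ ^ 2)

theorem stdGaussianDensity_pos (u : V) : 0 < stdGaussianDensity u := by
  unfold stdGaussianDensity
  positivity

theorem continuous_stdGaussianDensity : Continuous (stdGaussianDensity (V := V)) := by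
  unfold stdGaussianDensity
  fun_prop

theorem gaussianSmoothing_integrand_continuous {f : V → F} (hf : Continuous f) (σ : ℝ) (x : V) :
    Continuous fun u => stdGaussianDensity u • f (x - σ • u) :=
  continuous_stdGaussianDensity.smul (by fun_prop)

theorem norm_gaussianSmoothing_integrand_le {f : V → F} {C : ℝ} (hC : ∀ x, ‖f x‖ ≤ C)
    (σ : ℝ) (x u : V) : ‖stdGaussianDensity u • f (x - σ • u)‖ ≤ stdGaussianDensity u * C := by
  rw [norm_smul, Real.norm_of_nonneg (stdGaussianDensity_pos u).le]
  exact mul_le_mul_of_nonneg_left (hC _) (stdGaussianDensity_pos u).le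

variable [FiniteDimensional ℝ V] [MeasurableSpace V] [BorelSpace V]

theorem integral_stdGaussianDensity : ∫ u : V, stdGaussianDensity u = 1 := by
  unfold stdGaussianDensity
  rw [integral_const_mul, GaussianFourier.integral_rexp_neg_mul_sq_norm (by norm_num),
    show Real.pi / (1 / 2) = 2 * Real.pi by ring, ← Real.rpow_add (by positivity),
    neg_div, neg_add_cancel, Real.rpow_zero]

theorem integrable_stdGaussianDensity : Integrable (stdGaussianDensity (V := V)) := by
  by_contra h
  exact zero_ne_one ((integral_undef h).symm.trans integral_stdGaussianDensity)

/-- The expectation of `f (x - σ U)` for a standard Gaussian vector `U`. -/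
noncomputable def gaussianSmoothing (f : V → F) (σ : ℝ) (x : V) : F :=
  ∫ u, stdGaussianDensity u • f (x - σ • u)

theorem gaussianSmoothing_zero [CompleteSpace F] (f : V → F) (x : V) :
    gaussianSmoothing f 0 x = f x := by
  simp [gaussianSmoothing, integral_smul_const, integral_stdGaussianDensity]

theorem integrable_gaussianSmoothing_integrand {f : V → F} (hf : Continuous f) {C : ℝ}
    (hC : ∀ x, ‖f x‖ ≤ C) (σ : ℝ) (x : V) :
    Integrable fun u => stdGaussianDensity u • f (x - σ • u) :=
  (integrable_stdGaussianDensity.mul_const C).mono'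
    (gaussianSmoothing_integrand_continuous hf σ x).aestronglyMeasurable
    (.of_forall (norm_gaussianSmoothing_integrand_le hC σ x))

theorem continuous_gaussianSmoothing {f : V → F} (hf : Continuous f) {C : ℝ}
    (hC : ∀ x, ‖f x‖ ≤ C) : Continuous fun q : ℝ × V => gaussianSmoothing f q.1 q.2 := by
  refine continuous_of_dominated (bound := fun u => stdGaussianDensity u * C)
    (fun q => (gaussianSmoothing_integrand_continuous hf q.1 q.2).aestronglyMeasurable)
    (fun q => .of_forall (norm_gaussianSmoothing_integrand_le hC q.1 q.2))
    (integrable_stdGaussianDensity.mul_const C) (.of_forall fun u => ?_)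
  fun_prop

theorem gaussianSmoothing_pos {f : V → ℝ} (hf : Continuous f) {C : ℝ} (hC : ∀ x, ‖f x‖ ≤ C)
    (hpos : ∀ x, 0 < f x) (σ : ℝ) (x : V) : 0 < gaussianSmoothing f σ x := by
  have h : ∀ u, 0 < stdGaussianDensity u • f (x - σ • u) := fun u =>
    mul_pos (stdGaussianDensity_pos u) (hpos _)
  unfold gaussianSmoothing
  rw [integral_pos_iff_support_of_nonneg (fun u => (h u).le)
    (integrable_gaussianSmoothing_integrand hf hC σ x),
    Function.support_eq_univ fun u => (h u).ne']
  exact isOpen_univ.measure_pos volume Set.univ_nonempty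

theorem hasFDerivAt_gaussianSmoothing {f : V → F} (hf : ContDiff ℝ 1 f)
    {C C' : ℝ} (hC : ∀ x, ‖f x‖ ≤ C) (hC' : ∀ x, ‖fderiv ℝ f x‖ ≤ C') (σ : ℝ) (x : V) :
    HasFDerivAt (gaussianSmoothing f σ) (gaussianSmoothing (fderiv ℝ f) σ x) x := by
  refine hasFDerivAt_integral_of_dominated_of_fderiv_le (s := Set.univ)
    (F := fun x u => stdGaussianDensity u • f (x - σ • u))
    (F' := fun x u => stdGaussianDensity u • fderiv ℝ f (x - σ • u))
    (bound := fun u => stdGaussianDensity u * C') Filter.univ_mem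
    (.of_forall fun y =>
      (gaussianSmoothing_integrand_continuous hf.continuous σ y).aestronglyMeasurable)
    (integrable_gaussianSmoothing_integrand hf.continuous hC σ x)
    (gaussianSmoothing_integrand_continuous (hf.continuous_fderiv one_ne_zero)
      σ x).aestronglyMeasurable
    (.of_forall fun u y _ => norm_gaussianSmoothing_integrand_le hC' σ y u)
    (integrable_stdGaussianDensity.mul_const C') (.of_forall fun u y _ => ?_)
  have h := (hf.differentiable one_ne_zero (y - σ • u)).hasFDerivAt.comp y
    ((hasFDerivAt_id y).sub_const (σ • u))
  exact h.const_smul (stdGaussianDensity u)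

/-- Convolution with the centred Gaussian density of variance `σ ^ 2`, after rescaling. -/
theorem integral_mul_gaussian_eq_gaussianSmoothing (f : V → ℝ) {σ : ℝ} (hσ : 0 < σ) (x : V) :
    ∫ y, f y * ((2 * Real.pi * σ ^ 2) ^ (-(Module.finrank ℝ V : ℝ) / 2) *
      Real.exp (-‖x - y‖ ^ 2 / (2 * σ ^ 2))) = gaussianSmoothing f σ x := by
  set n := Module.finrank ℝ V
  set G : V → ℝ := fun z => f (x - z) * ((2 * Real.pi * σ ^ 2) ^ (-(n : ℝ) / 2) *
    Real.exp (-‖z‖ ^ 2 / (2 * σ ^ 2))) with hG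
  have hscale : ∫ u, G (σ • u) = (σ ^ n)⁻¹ • ∫ z, G z :=
    Measure.integral_comp_smul_of_nonneg volume G σ (hR := hσ.le)
  have hσn : (σ ^ 2) ^ (-(n : ℝ) / 2) = (σ ^ n)⁻¹ := by
    rw [← Real.rpow_natCast σ 2, ← Real.rpow_mul hσ.le, ← Real.rpow_natCast σ n,
      ← Real.rpow_neg hσ.le]
    congr 1
    push_cast
    ring
  have hpt : ∀ u, G (σ • u) = (σ ^ n)⁻¹ * (stdGaussianDensity u • f (x - σ • u)) := by
    intro u
    have he : -‖σ • u‖ ^ 2 / (2 * σ ^ 2) = -(1 / 2) * ‖u‖ ^ 2 := by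
      rw [norm_smul, Real.norm_of_nonneg hσ.le]
      field_simp
    simp only [hG, stdGaussianDensity, smul_eq_mul, he]
    rw [Real.mul_rpow (by positivity) (by positivity), hσn]
    ring
  calc _ = ∫ z, G z := by
        rw [← integral_sub_left_eq_self G volume x]
        simp [hG]
    _ = gaussianSmoothing f σ x := by
        simp_rw [hpt] at hscale
        rw [integral_const_mul, smul_eq_mul] at hscale
        exact (mul_left_cancel₀ (by positivity) hscale).symm

/-- The score of the Gaussian smoothing of `p`, extended to `σ = 0` by the score of `p`. -/
noncomputable def smoothedScore (p : V → ℝ) (σ : ℝ) (x : V) : V :=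
  gradient (fun z => Real.log (gaussianSmoothing p σ z)) x

theorem smoothedScore_zero (p : V → ℝ) (x : V) :
    smoothedScore p 0 x = gradient (fun z => Real.log (p z)) x := by
  simp [smoothedScore, gaussianSmoothing_zero]

theorem continuous_smoothedScore {p : V → ℝ} (hp : ContDiff ℝ 1 p) (hpos : ∀ x, 0 < p x)
    {C C' : ℝ} (hC : ∀ x, ‖p x‖ ≤ C) (hC' : ∀ x, ‖fderiv ℝ p x‖ ≤ C') :
    Continuous fun q : ℝ × V => smoothedScore p q.1 q.2 := by
  have hq := gaussianSmoothing_pos hp.continuous hC hpos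
  have h : (fun q : ℝ × V => smoothedScore p q.1 q.2) = fun q =>
      (InnerProductSpace.toDual ℝ V).symm
        ((gaussianSmoothing p q.1 q.2)⁻¹ • gaussianSmoothing (fderiv ℝ p) q.1 q.2) := by
    funext q
    have hd := (hasFDerivAt_gaussianSmoothing hp hC hC' q.1 q.2).log (hq q.1 q.2).ne'
    rw [smoothedScore, gradient, hd.fderiv]
  rw [h]
  exact (InnerProductSpace.toDual ℝ V).symm.continuous.comp
    (((continuous_gaussianSmoothing hp.continuous hC).inv₀ fun q => (hq q.1 q.2).ne').smul
      (continuous_gaussianSmoothing (hp.continuous_fderiv one_ne_zero) hC'))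

/-- Two averages `∫ T_θ w_θ` and `∫ T_θ v_θ` of fields with `‖w_θ - v_θ‖ ≤ ε` differ by at most
`ε` times the mean operator norm of `T`. -/
theorem norm_integral_clm_apply_sub_le {E G Θ : Type*} [NormedAddCommGroup E] [NormedSpace ℝ E]
    [NormedAddCommGroup G] [NormedSpace ℝ G] [MeasurableSpace Θ] {π : Measure Θ}
    {T : Θ → E →L[ℝ] G} {v w : Θ → E} (hTm : StronglyMeasurable T)
    (hT : Integrable (fun θ => ‖T θ‖) π) (hv : StronglyMeasurable v) (hw : StronglyMeasurable w)
    (hint : Integrable (fun θ => T θ (v θ)) π) {ε : ℝ} (hvw : ∀ θ, ‖w θ - v θ‖ ≤ ε) :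
    ‖∫ θ, T θ (w θ) ∂π - ∫ θ, T θ (v θ) ∂π‖ ≤ (∫ θ, ‖T θ‖ ∂π) * ε := by
  have hbound : ∀ θ, ‖T θ (w θ - v θ)‖ ≤ ‖T θ‖ * ε := fun θ => (T θ).le_opNorm_of_le (hvw θ)
  have hmeas : StronglyMeasurable fun θ => T θ (w θ - v θ) :=
    isBoundedBilinearMap_apply.continuous.comp_stronglyMeasurable (hTm.prodMk (hw.sub hv))
  have hdiff : Integrable (fun θ => T θ (w θ - v θ)) π :=
    (hT.mul_const ε).mono' hmeas.aestronglyMeasurable (.of_forall hbound)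
  have hsplit : ∀ θ, T θ (w θ) = T θ (w θ - v θ) + T θ (v θ) :=
    fun θ => by rw [map_sub, sub_add_cancel]
  rw [integral_congr_ae (.of_forall hsplit), integral_add hdiff hint, add_sub_cancel_right,
    ← integral_mul_const]
  exact norm_integral_le_of_norm_le (hT.mul_const ε) (.of_forall hbound)

end GaussianSmoothing

/-- **Proposition 4 (uniform convergence of the equivariant smoothed score).**
Let `p` be a positive `C¹` probability density on `ℝ^d` with `p` and `‖∇p‖` bounded, let
`p_σ` be its Gaussian smoothing and
`s_σ^π x = ∫ J_{g_θ}(x)ᵀ (∇ log p_σ)(g_θ x) dπ(θ)` the equivariant smoothed score. Assume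
the transformations map every compact into a bounded set, the Jacobians have uniformly
bounded first moment, and the score `s = ∇ log p` satisfies the π-equivariance identity.
Then `sup_{x ∈ K} ‖s x − s_σ^π x‖ → 0` as `σ → 0⁺`, for every compact `K`. -/
theorem equivariant_score_uniform_convergence (d : ℕ) (hd : 1 ≤ d)
    (p : EuclideanSpace ℝ (Fin d) → ℝ)
    (hpC : ContDiff ℝ 1 p) (hppos : ∀ x, 0 < p x) (hp1 : ∫ y, p y = 1)
    (Mp : ℝ) (hpbd : ∀ x, p x ≤ Mp) (hgradbd : ∀ x, ‖gradient p x‖ ≤ Mp)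
    (Θ : Type*) [MeasurableSpace Θ] (π : Measure Θ) [IsProbabilityMeasure π]
    (g : Θ → EuclideanSpace ℝ (Fin d) → EuclideanSpace ℝ (Fin d))
    (hgm : Measurable fun q : Θ × EuclideanSpace ℝ (Fin d) => g q.1 q.2)
    (hgC : ∀ θ, ContDiff ℝ 1 (g θ))
    (hJm : StronglyMeasurable fun q : Θ × EuclideanSpace ℝ (Fin d) =>
      fderiv ℝ (g q.1) q.2)
    (pσ : ℝ → EuclideanSpace ℝ (Fin d) → ℝ)
    (hpσ : ∀ σ : ℝ, 0 < σ → ∀ x, pσ σ x =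
      ∫ y, p y * ((2 * Real.pi * σ ^ 2) ^ (-(d : ℝ) / 2) *
        Real.exp (-‖x - y‖ ^ 2 / (2 * σ ^ 2))))
    (sσπ : ℝ → EuclideanSpace ℝ (Fin d) → EuclideanSpace ℝ (Fin d))
    (hsσπ : ∀ σ x, sσπ σ x = ∫ θ, ContinuousLinearMap.adjoint (fderiv ℝ (g θ) x)
      (gradient (fun z => Real.log (pσ σ z)) (g θ x)) ∂π)
    (hgbd : ∀ K : Set (EuclideanSpace ℝ (Fin d)), IsCompact K →
      ∃ CK : ℝ, ∀ x ∈ K, ∀ θ, ‖g θ x‖ ≤ CK)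
    (hJint : ∀ x, Integrable (fun θ => ‖fderiv ℝ (g θ) x‖) π)
    (A : ℝ) (hA : ∀ x, ∫ θ, ‖fderiv ℝ (g θ) x‖ ∂π ≤ A)
    (hsint : ∀ x, Integrable (fun θ => ContinuousLinearMap.adjoint (fderiv ℝ (g θ) x)
      (gradient (fun z => Real.log (p z)) (g θ x))) π)
    (hequiv : ∀ x, gradient (fun z => Real.log (p z)) x =
      ∫ θ, ContinuousLinearMap.adjoint (fderiv ℝ (g θ) x)
        (gradient (fun z => Real.log (p z)) (g θ x)) ∂π)
    (K : Set (EuclideanSpace ℝ (Fin d))) (hK : IsCompact K) :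
    TendstoUniformlyOn (fun σ x => sσπ σ x)
      (fun x => gradient (fun z => Real.log (p z)) x)
      (nhdsWithin (0 : ℝ) (Set.Ioi 0)) K := by
  have hC : ∀ x, ‖p x‖ ≤ Mp := fun x => by
    rw [Real.norm_of_nonneg (hppos x).le]
    exact hpbd x
  have hC' : ∀ x, ‖fderiv ℝ p x‖ ≤ Mp := fun x => by
    simpa [gradient] using hgradbd x
  have hcont := continuous_smoothedScore hpC hppos hC hC'
  have hscore : ∀ σ, 0 < σ → ∀ x,
      gradient (fun z => Real.log (pσ σ z)) x = smoothedScore p σ x := by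
    intro σ hσ x
    have h : pσ σ = gaussianSmoothing p σ := funext fun z => by
      rw [hpσ σ hσ z, ← integral_mul_gaussian_eq_gaussianSmoothing p hσ z,
        finrank_euclideanSpace_fin]
    rw [smoothedScore, h]
  simp_rw [← smoothedScore_zero p] at hsint hequiv ⊢
  have hmeas : ∀ σ x, StronglyMeasurable fun θ => smoothedScore p σ (g θ x) := fun σ x =>
    ((hcont.comp (Continuous.prodMk_right σ)).measurable.comp
      (hgm.comp measurable_prodMk_right)).stronglyMeasurable
  obtain ⟨CK, hCK⟩ := hgbd K hK
  rw [Metric.tendstoUniformlyOn_iff]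
  intro ε hε
  have hA1 : 0 < |A| + 1 := by positivity
  obtain ⟨v, hv, hvK⟩ := IsCompact.mem_uniformity_of_prod
    (isCompact_closedBall (0 : EuclideanSpace ℝ (Fin d)) CK) (f := smoothedScore p) (s := Set.univ) (q := 0) hcont.continuousOn (Set.mem_univ _)
    (Metric.dist_mem_uniformity (div_pos hε hA1))
  rw [nhdsWithin_univ] at hv
  filter_upwards [mem_nhdsWithin_of_mem_nhds hv, self_mem_nhdsWithin] with σ hσv hσ x hx
  have hclose : ∀ θ, ‖smoothedScore p σ (g θ x) - smoothedScore p 0 (g θ x)‖ ≤ ε / (|A| + 1) :=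
    fun θ => by
      rw [← dist_eq_norm]
      exact (hvK σ hσv _ (mem_closedBall_zero_iff.2 (hCK x hx θ))).le
  have hJx : StronglyMeasurable fun θ => fderiv ℝ (g θ) x :=
    hJm.comp_measurable measurable_prodMk_right
  have hnorm : ∀ θ, ‖ContinuousLinearMap.adjoint (fderiv ℝ (g θ) x)‖ = ‖fderiv ℝ (g θ) x‖ :=
    fun θ => LinearIsometryEquiv.norm_map _ _
  have hle := norm_integral_clm_apply_sub_le
    (ContinuousLinearMap.adjoint.continuous.comp_stronglyMeasurable hJx)
    (by simpa only [hnorm] using hJint x) (hmeas 0 x) (hmeas σ x) (hsint x) hclose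
  simp_rw [hnorm] at hle
  rw [dist_comm, dist_eq_norm, hsσπ, hequiv x]
  simp_rw [hscore σ hσ]
  calc _ ≤ (∫ θ, ‖fderiv ℝ (g θ) x‖ ∂π) * (ε / (|A| + 1)) := hle
    _ ≤ |A| * (ε / (|A| + 1)) :=
        mul_le_mul_of_nonneg_right ((hA x).trans (le_abs_self A)) (by positivity)
    _ < ε := by
        rw [mul_div_assoc', div_lt_iff₀ hA1]
        nlinarith
end
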